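/- Let B₁ : Matrix (Fin n₁) (Fin m₁) ℝ and B₂ : Matrix (Fin n₂) (Fin m₂) ℝ be incidence matrices of two signed graphs Γ₁, Γ₂ whose subdivision signed graphs are noncospectral and equienergetic, i.e. charpoly(M_1 B₁) ≠ charpoly(M_1 B₂) and energy(M_1 B₁) = energy(M_1 B₂). Then for every positive integer p, the signed graphs S_p(Γ₁) and S_p(Γ₂) are noncospectral and equienergetic: charpoly(M_p B₁) ≠ charpoly(M_p B₂) and energy(M_p B₁) = energy(M_p B₂). -/

import Mathlib

open Matrix

/-- `B` is an incidence matrix of a signed graph: each column has exactly two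
nonzero entries, each equal to `1` or `-1`. -/
def IsIncidence {n m : ℕ} (B : Matrix (Fin n) (Fin m) ℝ) : Prop :=
  ∀ j : Fin m, ∃ a b : Fin n, a ≠ b ∧
    (B a j = 1 ∨ B a j = -1) ∧ (B b j = 1 ∨ B b j = -1) ∧
    ∀ c : Fin n, c ≠ a → c ≠ b → B c j = 0

/-- Adjacency matrix of the signed graph `S_p(Γ)` of Operation 4.1, built from an
incidence matrix `B` of `Γ`; `Mp 1 B` is the adjacency matrix of the subdivision
signed graph `S(Γ)`. -/
def Mp {n m : ℕ} (p : ℕ) (B : Matrix (Fin n) (Fin m) ℝ) :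
    Matrix (Fin n ⊕ (Fin p × Fin m)) (Fin n ⊕ (Fin p × Fin m)) ℝ :=
  Matrix.of fun x y =>
    match x, y with
    | Sum.inl i, Sum.inr aj => B i aj.2
    | Sum.inr aj, Sum.inl i => B i aj.2
    | _, _ => 0

/-- The energy of a real symmetric matrix: the sum of the absolute values of its
eigenvalues, listed with multiplicity. -/
noncomputable def energy {N : Type*} [Fintype N] [DecidableEq N]
    (A : Matrix N N ℝ) : ℝ := by
  classical exact if h : A.IsHermitian then ∑ i, |h.eigenvalues i| else 0

open Polynomial in
/-- The sum of the squared roots of the characteristic polynomial of a real symmetric matrix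
is the trace of its square. -/
theorem Matrix.IsHermitian.sum_roots_charpoly_sq {N : Type*} [Fintype N] [DecidableEq N]
    {A : Matrix N N ℝ} (hA : A.IsHermitian) :
    (A.charpoly.roots.map fun x => x ^ 2).sum = (A * A).trace := by
  have h : A * A = Unitary.conjStarAlgAut ℝ _ hA.eigenvectorUnitary
      (diagonal (RCLike.ofReal ∘ hA.eigenvalues) * diagonal (RCLike.ofReal ∘ hA.eigenvalues)) := by
    rw [map_mul, ← hA.spectral_theorem]
  rw [h, Unitary.conjStarAlgAut_apply, trace_mul_comm, ← mul_assoc, Unitary.coe_star_mul_self,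
    one_mul, diagonal_mul_diagonal, trace_diagonal, hA.roots_charpoly_eq_eigenvalues]
  simp [sq]

theorem energy_eq_sum_roots {N : Type*} [Fintype N] [DecidableEq N]
    {A : Matrix N N ℝ} (hA : A.IsHermitian) :
    energy A = (A.charpoly.roots.map fun x => |x|).sum := by
  rw [hA.roots_charpoly_eq_eigenvalues, energy, dif_pos hA]
  simp only [Multiset.map_map]
  rfl

theorem Mp_isHermitian {n m : ℕ} (p : ℕ) (B : Matrix (Fin n) (Fin m) ℝ) :
    (Mp p B).IsHermitian := by
  ext x y
  rcases x with x | x <;> rcases y with y | y <;> simp [Mp]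

theorem IsIncidence.sum_sq_col {n m : ℕ} {B : Matrix (Fin n) (Fin m) ℝ} (h : IsIncidence B)
    (j : Fin m) : ∑ i, B i j ^ 2 = 2 := by
  obtain ⟨a, b, hab, ha, hb, hc⟩ := h j
  rw [Fintype.sum_eq_add a b hab fun c hcab => by simp [hc c hcab.1 hcab.2]]
  rcases ha with ha | ha <;> rcases hb with hb | hb <;> norm_num [ha, hb]

theorem IsIncidence.trace_Mp_mul_self {n m : ℕ} {B : Matrix (Fin n) (Fin m) ℝ}
    (h : IsIncidence B) (p : ℕ) : (Mp p B * Mp p B).trace = 4 * p * m := by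
  have hs : ∑ i, ∑ j, B i j ^ 2 = 2 * m := by
    rw [Finset.sum_comm]
    simp [h.sum_sq_col, mul_comm]
  simp only [trace, diag, mul_apply, Fintype.sum_sum_type, Fintype.sum_prod_type, Mp, of_apply,
    ← sq, Finset.sum_const, Finset.card_univ, Fintype.card_fin, nsmul_eq_mul, h.sum_sq_col]
  simp [← Finset.mul_sum, hs]
  ring

/-- The adjacency matrix of `S_p(Γ)` in block form. -/
theorem Mp_eq_fromBlocks {n m : ℕ} (p : ℕ) (B : Matrix (Fin n) (Fin m) ℝ) :
    Mp p B = fromBlocks 0 (B.submatrix id Prod.snd) (B.submatrix id Prod.snd)ᵀ 0 := by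
  ext x y
  rcases x with x | x <;> rcases y with y | y <;> simp [Mp]

/-- The characteristic polynomial of `S_p(Γ)` in terms of the signed Laplacian of `Γ`. -/
theorem eval_charpoly_Mp {n m : ℕ} (p : ℕ) (B : Matrix (Fin n) (Fin m) ℝ) (t : ℝ) :
    t ^ n * (Mp p B).charpoly.eval t =
      t ^ (p * m) * (t ^ 2 • (1 : Matrix (Fin n) (Fin n) ℝ) - (p : ℝ) • (B * Bᵀ)).det := by
  set C : Matrix (Fin n) (Fin p × Fin m) ℝ := B.submatrix id Prod.snd with hC
  have hCC : C * Cᵀ = (p : ℝ) • (B * Bᵀ) := by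
    ext i j
    simp [hC, mul_apply, Fintype.sum_prod_type]
  have hdet : (Mp p B).charpoly.eval t = (fromBlocks (t • 1) (-C) (-Cᵀ) (t • 1)).det := by
    rw [eval_charpoly, Mp_eq_fromBlocks]
    congr 1
    ext x y
    rcases x with x | x <;> rcases y with y | y <;> simp [hC, one_apply, diagonal_apply]
  have hmul : fromBlocks (t • 1) (-C) (-Cᵀ) (t • 1) * fromBlocks (t • 1) 0 Cᵀ 1 =
      fromBlocks (t ^ 2 • 1 - (p : ℝ) • (B * Bᵀ)) (-C) 0 (t • 1) := by
    rw [fromBlocks_multiply, ← hCC]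
    congr 1 <;> simp [sq, smul_smul, sub_eq_add_neg]
  have h := congrArg det hmul
  rw [det_mul, det_fromBlocks_zero₁₂, det_fromBlocks_zero₂₁, ← hdet] at h
  simp only [det_smul, det_one, Fintype.card_fin, Fintype.card_prod, mul_one] at h
  linear_combination h

theorem natDegree_charpoly_Mp {n m : ℕ} (p : ℕ) (B : Matrix (Fin n) (Fin m) ℝ) :
    (Mp p B).charpoly.natDegree = n + p * m := by
  simp [charpoly_natDegree_eq_dim]

open Polynomial in
/-- The spectrum of `S_{q+1}(Γ)` is that of `S(Γ)`, extended by zeros, scaled by `√(q + 1)`. -/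
theorem charpoly_Mp_succ {n m : ℕ} (q : ℕ) (B : Matrix (Fin n) (Fin m) ℝ) :
    (Mp (q + 1) B).charpoly =
      (X ^ (q * m) * (Mp 1 B).charpoly).scaleRoots (√(q + 1)) := by
  have hr0 : √((q : ℝ) + 1) ≠ 0 := by positivity
  have hr2 : √((q : ℝ) + 1) ^ 2 = q + 1 := Real.sq_sqrt (by positivity)
  generalize √((q : ℝ) + 1) = r at hr0 hr2
  have hdeg : (X ^ (q * m) * (Mp 1 B).charpoly).natDegree = q * m + (n + m) := by
    rw [(monic_X_pow _).natDegree_mul (charpoly_monic _), natDegree_X_pow, natDegree_charpoly_Mp,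
      one_mul]
  refine mul_left_cancel₀ (pow_ne_zero n X_ne_zero) (Polynomial.funext fun t => ?_)
  obtain ⟨s, rfl⟩ : ∃ s, t = r * s := ⟨t / r, by field_simp⟩
  have hdet : ((r * s) ^ 2 • (1 : Matrix (Fin n) (Fin n) ℝ) -
      ((q + 1 : ℕ) : ℝ) • (B * Bᵀ)).det =
      r ^ (2 * n) * (s ^ 2 • (1 : Matrix (Fin n) (Fin n) ℝ) - ((1 : ℕ) : ℝ) • (B * Bᵀ)).det := by
    have h := det_smul (s ^ 2 • (1 : Matrix (Fin n) (Fin n) ℝ) - ((1 : ℕ) : ℝ) • (B * Bᵀ)) (r ^ 2)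
    rw [Fintype.card_fin, ← pow_mul] at h
    rw [← h, smul_sub, smul_smul, smul_smul, ← mul_pow, Nat.cast_one, mul_one, hr2, Nat.cast_succ]
  have hp := eval_charpoly_Mp (q + 1) B (r * s)
  have h1 := eval_charpoly_Mp 1 B s
  rw [hdet] at hp
  rw [eval_mul, eval_mul, eval_pow, eval_X, hp, scaleRoots_eval_mul, hdeg, eval_mul, eval_pow,
    eval_X]
  linear_combination (-r ^ (2 * n + q * m + m) * s ^ (q * m)) * h1

theorem energy_Mp_succ {n m : ℕ} (q : ℕ) (B : Matrix (Fin n) (Fin m) ℝ) :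
    energy (Mp (q + 1) B) = √(q + 1) * energy (Mp 1 B) := by
  have hr0 : √((q : ℝ) + 1) ≠ 0 := by positivity
  rw [energy_eq_sum_roots (Mp_isHermitian _ B), energy_eq_sum_roots (Mp_isHermitian _ B),
    charpoly_Mp_succ, Polynomial.roots_scaleRoots _ hr0.isUnit, Polynomial.roots_mul
      (mul_ne_zero (pow_ne_zero _ Polynomial.X_ne_zero) (charpoly_monic _).ne_zero)]
  simp [Multiset.map_map, abs_mul, Multiset.sum_map_mul_left,
    abs_of_nonneg (Real.sqrt_nonneg _), Multiset.map_nsmul, Multiset.sum_nsmul]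

theorem scaleRoots_injective {R : Type*} [CommRing R] [IsDomain R] {r : R} (hr : r ≠ 0) :
    Function.Injective fun f : Polynomial R => f.scaleRoots r := by
  intro f g h
  have hd : f.natDegree = g.natDegree := by
    simpa using congrArg Polynomial.natDegree h
  ext i
  have hi := congrArg (fun f => Polynomial.coeff f i) h
  simp only [Polynomial.coeff_scaleRoots, hd] at hi
  exact mul_right_cancel₀ (pow_ne_zero _ hr) hi


/-- Corollary 4.11(i): if the subdivision signed graphs of `Γ₁` and `Γ₂` are
noncospectral and equienergetic, then so are `S_p(Γ₁)` and `S_p(Γ₂)` for every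
positive integer `p`. -/
theorem Mp_noncospectral_equienergetic {n₁ m₁ n₂ m₂ : ℕ}
    (B₁ : Matrix (Fin n₁) (Fin m₁) ℝ) (B₂ : Matrix (Fin n₂) (Fin m₂) ℝ)
    (h₁ : IsIncidence B₁) (h₂ : IsIncidence B₂)
    (hnc : (Mp 1 B₁).charpoly ≠ (Mp 1 B₂).charpoly)
    (he : energy (Mp 1 B₁) = energy (Mp 1 B₂))
    (p : ℕ) (hp : 0 < p) :
    (Mp p B₁).charpoly ≠ (Mp p B₂).charpoly ∧
      energy (Mp p B₁) = energy (Mp p B₂) := by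
  obtain ⟨q, rfl⟩ := Nat.exists_eq_add_of_lt hp
  rw [zero_add]
  refine ⟨fun h => hnc ?_, by rw [energy_Mp_succ q B₁, energy_Mp_succ q B₂, he]⟩
  have hm : m₁ = m₂ := by
    have ht := (Mp_isHermitian (q + 1) B₁).sum_roots_charpoly_sq
    rw [h, (Mp_isHermitian (q + 1) B₂).sum_roots_charpoly_sq, h₁.trace_Mp_mul_self,
      h₂.trace_Mp_mul_self] at ht
    have hq : (4 * ((q + 1 : ℕ) : ℝ)) ≠ 0 := by positivity
    exact_mod_cast (mul_left_cancel₀ hq ht).symm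
  subst hm
  rw [charpoly_Mp_succ q B₁, charpoly_Mp_succ q B₂] at h
  have hr0 : √((q : ℝ) + 1) ≠ 0 := by positivity
  have hX := scaleRoots_injective hr0 h
  exact mul_left_cancel₀ (pow_ne_zero (q * m₁) Polynomial.X_ne_zero) hX
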